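/- arXiv:1405.4726 — 2 statements merged into one kernel-verified Lean document; each statement's English description precedes it below -/
import Mathlib

section
/- For twist angle φ = π, every N ≥ 1, all nonzero complex w₁,…,w_N and every nonzero complex z, the fundamental transfer matrix annihilates the Bethe vector: T^{(1)}(z|w₁,…,w_N) |Ψ(w₁,…,w_N)⟩ = i(𝒜(z) − 𝒟(z)) |Ψ(w₁,…,w_N)⟩ = 0. -/
open Matrix BigOperators Finset

noncomputable section

/-- `[z] = z - z⁻¹`. -/
def br (z : ℂ) : ℂ := z - z⁻¹

/-- R-matrix `R^{(1,2)}(z)` on ℂ²⊗ℂ³; basis `(ε, σ)` with ε ∈ {0=↑,1=↓}, σ ∈ {0=⇑,1=0,2=⇓}. -/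
def R12 (q c z : ℂ) : Matrix (Fin 2 × Fin 3) (Fin 2 × Fin 3) ℂ :=
  Matrix.of fun p p' =>
    if p = (0,0) ∧ p' = (0,0) then br (q^2*z)
    else if p = (0,1) ∧ p' = (0,1) then br (q*z)
    else if p = (0,2) ∧ p' = (0,2) then br z
    else if p = (1,0) ∧ p' = (1,0) then br z
    else if p = (1,1) ∧ p' = (1,1) then br (q*z)
    else if p = (1,2) ∧ p' = (1,2) then br (q^2*z)
    else if p = (0,1) ∧ p' = (1,0) then c
    else if p = (0,2) ∧ p' = (1,1) then c
    else if p = (1,0) ∧ p' = (0,1) then c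
    else if p = (1,1) ∧ p' = (0,2) then c
    else 0

/-- `R^{(1,2)}` acting on the auxiliary ℂ² and the j-th site of `(ℂ³)^{⊗N}`. -/
def R12at (q c z : ℂ) {N : ℕ} (j : Fin N) :
    Matrix (Fin 2 × (Fin N → Fin 3)) (Fin 2 × (Fin N → Fin 3)) ℂ :=
  Matrix.of fun p p' =>
    R12 q c z (p.1, p.2 j) (p'.1, p'.2 j) *
      if ∀ k, k ≠ j → p.2 k = p'.2 k then 1 else 0

/-- Monodromy matrix `𝒯_a(z) = R^{(1,2)}_{a,N}(q⁻¹z/w_N) ⋯ R^{(1,2)}_{a,1}(q⁻¹z/w₁)`. -/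
def monodromy (q c : ℂ) {N : ℕ} (w : Fin N → ℂ) (z : ℂ) :
    Matrix (Fin 2 × (Fin N → Fin 3)) (Fin 2 × (Fin N → Fin 3)) ℂ :=
  (((List.finRange N).reverse).map fun j => R12at q c (q⁻¹ * z / w j) j).prod

/-- The operator 𝒜(z): auxiliary block (↑,↑) of the monodromy matrix. -/
def Aop (q c : ℂ) {N : ℕ} (w : Fin N → ℂ) (z : ℂ) :
    Matrix (Fin N → Fin 3) (Fin N → Fin 3) ℂ :=
  Matrix.of fun σ τ => monodromy q c w z (0, σ) (0, τ)

/-- The operator ℬ(z): auxiliary block (↑,↓) of the monodromy matrix. -/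
def Bop (q c : ℂ) {N : ℕ} (w : Fin N → ℂ) (z : ℂ) :
    Matrix (Fin N → Fin 3) (Fin N → Fin 3) ℂ :=
  Matrix.of fun σ τ => monodromy q c w z (0, σ) (1, τ)

/-- The operator 𝒟(z): auxiliary block (↓,↓) of the monodromy matrix. -/
def Dop (q c : ℂ) {N : ℕ} (w : Fin N → ℂ) (z : ℂ) :
    Matrix (Fin N → Fin 3) (Fin N → Fin 3) ℂ :=
  Matrix.of fun σ τ => monodromy q c w z (1, σ) (1, τ)

/-- Bethe reference state `|∧⟩ = |⇑…⇑⟩`. -/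
def vac (N : ℕ) : (Fin N → Fin 3) → ℂ := fun σ => if σ = fun _ => 0 then 1 else 0

/-- Bethe vector `|Ψ(w₁,…,w_N)⟩ = ℬ(w₁)⋯ℬ(w_N)|∧⟩`. -/
def bethe (q c : ℂ) {N : ℕ} (w : Fin N → ℂ) : (Fin N → Fin 3) → ℂ :=
  (((List.finRange N).map fun j => Bop q c w (w j)).prod).mulVec (vac N)

/-- `T ⊗ 1`. -/
def firstLeg {M : Type*} [Ring M] : Matrix (Fin 2) (Fin 2) M →* Matrix (Fin 2 × Fin 2) (Fin 2 × Fin 2) M where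
  toFun T := Matrix.of fun p r => if p.2 = r.2 then T p.1 r.1 else 0
  map_one' := by
    ext ⟨i, j⟩ ⟨k, l⟩
    fin_cases i <;> fin_cases j <;> fin_cases k <;> fin_cases l <;> simp
  map_mul' S T := by
    ext ⟨i, j⟩ ⟨k, l⟩
    fin_cases j <;> fin_cases l <;> simp [Matrix.mul_apply, Fintype.sum_prod_type]

/-- `1 ⊗ T`. -/
def secondLeg {M : Type*} [Ring M] : Matrix (Fin 2) (Fin 2) M →* Matrix (Fin 2 × Fin 2) (Fin 2 × Fin 2) M where
  toFun T := Matrix.of fun p r => if p.1 = r.1 then T p.2 r.2 else 0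
  map_one' := by
    ext ⟨i, j⟩ ⟨k, l⟩
    fin_cases i <;> fin_cases j <;> fin_cases k <;> fin_cases l <;> simp
  map_mul' S T := by
    ext ⟨i, j⟩ ⟨k, l⟩
    fin_cases i <;> fin_cases k <;> simp [Matrix.mul_apply, Fintype.sum_prod_type]

lemma commute_firstLeg_secondLeg {M : Type*} [Ring M] {S T : Matrix (Fin 2) (Fin 2) M}
    (h : ∀ a b a' b', Commute (S a b) (T a' b')) : Commute (firstLeg S) (secondLeg T) := by
  ext ⟨i, j⟩ ⟨k, l⟩
  fin_cases i <;> fin_cases j <;> fin_cases k <;> fin_cases l <;>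
    simp [firstLeg, secondLeg, Matrix.mul_apply, Fintype.sum_prod_type, (h _ _ _ _).eq]

/-- The six-vertex R-matrix on `ℂ² ⊗ ℂ²`. -/
def sixVertex (q x : ℂ) : Matrix (Fin 2 × Fin 2) (Fin 2 × Fin 2) ℂ :=
  Matrix.of fun p r =>
    if p = r then (if p.1 = p.2 then br (q * x) else br x)
    else if p = r.swap then br q else 0

/-- The 2×2 block form of `R12`. -/
def lax (q c y : ℂ) : Matrix (Fin 2) (Fin 2) (Matrix (Fin 3) (Fin 3) ℂ) :=
  Matrix.of fun a b => Matrix.of fun s t => R12 q c y (a, s) (b, t)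

/-- The Yang–Baxter exchange relation. -/
def Exchange {M : Type*} [Ring M] (R : Matrix (Fin 2 × Fin 2) (Fin 2 × Fin 2) M)
    (S T : Matrix (Fin 2) (Fin 2) M) : Prop :=
  R * firstLeg S * secondLeg T = secondLeg T * firstLeg S * R

lemma Exchange.mul {M : Type*} [Ring M] {R : Matrix (Fin 2 × Fin 2) (Fin 2 × Fin 2) M}
    {S T S' T' : Matrix (Fin 2) (Fin 2) M} (h : Exchange R S T) (h' : Exchange R S' T')
    (h₁ : ∀ a b a' b', Commute (S a b) (T' a' b'))
    (h₂ : ∀ a b a' b', Commute (S' a b) (T a' b')) : Exchange R (S * S') (T * T') := by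
  have k₁ := (commute_firstLeg_secondLeg h₁).eq
  have k₂ := (commute_firstLeg_secondLeg h₂).eq
  unfold Exchange at *
  simp only [map_mul]
  calc R * (firstLeg S * firstLeg S') * (secondLeg T * secondLeg T')
      = R * firstLeg S * (firstLeg S' * secondLeg T) * secondLeg T' := by noncomm_ring
    _ = (R * firstLeg S * secondLeg T) * firstLeg S' * secondLeg T' := by rw [k₂]; noncomm_ring
    _ = secondLeg T * firstLeg S * (R * firstLeg S' * secondLeg T') := by rw [h]; noncomm_ring
    _ = secondLeg T * (firstLeg S * secondLeg T') * firstLeg S' * R := by rw [h']; noncomm_ring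
    _ = _ := by rw [k₁]; noncomm_ring

lemma lax_apply (q c y : ℂ) :
    lax q c y = !![!![br (q^2*y), 0, 0; 0, br (q*y), 0; 0, 0, br y], !![0, 0, 0; c, 0, 0; 0, c, 0];
      !![0, c, 0; 0, 0, c; 0, 0, 0], !![br y, 0, 0; 0, br (q*y), 0; 0, 0, br (q^2*y)]] := by
  ext i j s t
  fin_cases i <;> fin_cases j <;> fin_cases s <;> fin_cases t <;> simp [lax, R12]

set_option maxHeartbeats 4000000 in
lemma exchange_lax {q c y y' : ℂ} (hq : q ≠ 0) (hc : c ^ 2 = br q * br (q ^ 2)) (hy : y ≠ 0)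
    (hy' : y' ≠ 0) :
    Exchange ((sixVertex q (y / y')).map (algebraMap ℂ (Matrix (Fin 3) (Fin 3) ℂ)))
      (lax q c y) (lax q c y') := by
  have hc' : q ^ 3 * c ^ 2 = (q ^ 2 - 1) * (q ^ 4 - 1) := by
    rw [hc]; unfold br; field_simp
  rw [lax_apply, lax_apply]
  unfold Exchange
  ext ⟨i, j⟩ ⟨k, l⟩ : 2
  fin_cases i <;> fin_cases j <;> fin_cases k <;> fin_cases l <;>
    simp [firstLeg, secondLeg, Matrix.mul_apply, Fintype.sum_prod_type, sixVertex,
      Algebra.algebraMap_eq_smul_one]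
  all_goals
    rename_i s t
    fin_cases s <;> fin_cases t <;>
      simp [-mul_eq_mul_left_iff, -mul_eq_mul_right_iff, -mul_eq_zero, -zero_eq_mul]
  all_goals
    simp only [br]
    field_simp <;>
    first
    | ring1
    | linear_combination (y ^ 2 - y' ^ 2) * hc'
    | linear_combination (y' ^ 2 - y ^ 2) * hc'


/-- A one-site operator acting on the `j`-th factor of `(ℂ³)^{⊗N}`. -/
def siteOp {N : ℕ} (j : Fin N) :
    Matrix (Fin 3) (Fin 3) ℂ →ₐ[ℂ] Matrix (Fin N → Fin 3) (Fin N → Fin 3) ℂ :=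
  AlgHom.ofLinearMap
    { toFun := fun X => Matrix.of fun σ τ =>
        X (σ j) (τ j) * if ∀ k, k ≠ j → σ k = τ k then 1 else 0
      map_add' := fun X Y => by ext σ τ; simp only [Matrix.of_apply, Matrix.add_apply, add_mul]
      map_smul' := fun r X => by ext σ τ; simp }
    (by
      ext σ τ
      by_cases h : σ = τ
      · subst h; simp
      · by_cases hj : σ j = τ j
        · have : ¬ ∀ k, k ≠ j → σ k = τ k := fun h' => h <| funext fun k => by
            by_cases hk : k = j
            · rw [hk, hj]
            · exact h' k hk
          simp [h, this]
        · simp [h, hj])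
    (by
      intro X Y
      ext σ τ
      simp only [LinearMap.coe_mk, AddHom.coe_mk, Matrix.mul_apply, Matrix.of_apply]
      by_cases h : ∀ k, k ≠ j → σ k = τ k
      · rw [if_pos h, mul_one]
        refine Finset.sum_of_injOn (fun s => Function.update σ j s) ?_ (by simp) ?_ ?_
        · intro s _ t _ hst
          simpa using congrFun hst j
        · intro ρ _ hρ
          have : ¬ ∀ k, k ≠ j → σ k = ρ k := fun h' => hρ ⟨ρ j, by simp, by
            ext k
            by_cases hk : k = j
            · subst hk; simp
            · simp [hk, h' k hk]⟩
          simp [this]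
        · intro s _
          have h₁ : ∀ k, k ≠ j → σ k = Function.update σ j s k := fun k hk => by simp [hk]
          have h₂ : ∀ k, k ≠ j → Function.update σ j s k = τ k := fun k hk => by simp [hk, h k hk]
          rw [if_pos h₁, if_pos h₂]
          simp
      · rw [if_neg h, mul_zero]
        symm
        refine Finset.sum_eq_zero fun ρ _ => ?_
        by_cases h₁ : ∀ k, k ≠ j → σ k = ρ k
        · have h₂ : ¬ ∀ k, k ≠ j → ρ k = τ k := fun h₂ => h fun k hk => (h₁ k hk).trans (h₂ k hk)
          simp [h₂]
        · simp [h₁])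

lemma siteOp_apply {N : ℕ} (j : Fin N) (X : Matrix (Fin 3) (Fin 3) ℂ) (σ τ : Fin N → Fin 3) :
    siteOp j X σ τ = X (σ j) (τ j) * if ∀ k, k ≠ j → σ k = τ k then 1 else 0 := rfl

lemma siteOp_mul_siteOp_apply {N : ℕ} {i j : Fin N} (hij : i ≠ j) (X Y : Matrix (Fin 3) (Fin 3) ℂ)
    (σ τ : Fin N → Fin 3) :
    (siteOp i X * siteOp j Y) σ τ = X (σ i) (τ i) * Y (σ j) (τ j) *
      if ∀ k, k ≠ i → k ≠ j → σ k = τ k then 1 else 0 := by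
  rw [Matrix.mul_apply, Finset.sum_eq_single (Function.update σ i (τ i))]
  · have h₁ : ∀ k, k ≠ i → σ k = Function.update σ i (τ i) k := fun k hk => by simp [hk]
    have h₂ : (∀ k, k ≠ j → Function.update σ i (τ i) k = τ k) ↔
        ∀ k, k ≠ i → k ≠ j → σ k = τ k := by
      refine forall_congr' fun k => ?_
      by_cases hk : k = i
      · subst hk; simp
      · simp [hk]
    simp only [siteOp_apply, if_pos h₁, h₂]
    simp [hij.symm]
  · intro ρ _ hρ
    simp only [siteOp_apply]
    by_cases h₁ : ∀ k, k ≠ i → σ k = ρ k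
    · have h₂ : ¬ ∀ k, k ≠ j → ρ k = τ k := fun h₂ => hρ <| by
        ext k
        by_cases hk : k = i
        · subst hk; simp [h₂ k hij]
        · simp [hk, h₁ k hk]
      simp [h₂]
    · simp [h₁]
  · simp

lemma commute_siteOp {N : ℕ} {i j : Fin N} (hij : i ≠ j) (X Y : Matrix (Fin 3) (Fin 3) ℂ) :
    Commute (siteOp i X) (siteOp j Y) := by
  ext σ τ
  rw [siteOp_mul_siteOp_apply hij, siteOp_mul_siteOp_apply hij.symm, mul_comm (X _ _)]
  congr 2
  exact propext ⟨fun h k h₁ h₂ => h k h₂ h₁, fun h k h₁ h₂ => h k h₂ h₁⟩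

lemma mulVec_vac {N : ℕ} (X : Matrix (Fin N → Fin 3) (Fin N → Fin 3) ℂ) :
    X *ᵥ vac N = fun σ => X σ fun _ => 0 := by
  ext σ
  simp [Matrix.mulVec, dotProduct, vac]

lemma siteOp_mulVec_vac {N : ℕ} (j : Fin N) {X : Matrix (Fin 3) (Fin 3) ℂ} {r : ℂ}
    (h₀ : X 0 0 = r) (h₁ : X 1 0 = 0) (h₂ : X 2 0 = 0) :
    siteOp j X *ᵥ vac N = r • vac N := by
  rw [mulVec_vac]
  ext σ
  have h : X (σ j) 0 = if σ j = 0 then r else 0 := by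
    generalize σ j = s
    fin_cases s <;> simp [h₀, h₁, h₂]
  have h' : (σ = fun _ => 0) ↔ σ j = 0 ∧ ∀ k, k ≠ j → σ k = 0 := by
    refine ⟨fun h => by simp [h], fun h => funext fun k => ?_⟩
    by_cases hk : k = j
    · rw [hk, h.1]
    · exact h.2 k hk
  simp only [siteOp_apply, h, Pi.smul_apply, vac, h', smul_eq_mul]
  by_cases h1 : σ j = 0 <;> simp [h1]

lemma Exchange.map {M M' : Type*} [Ring M] [Ring M'] (φ : M →+* M')
    {R : Matrix (Fin 2 × Fin 2) (Fin 2 × Fin 2) M} {S T : Matrix (Fin 2) (Fin 2) M}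
    (h : Exchange R S T) : Exchange (R.map φ) (S.map φ) (T.map φ) := by
  have h₁ (X : Matrix (Fin 2) (Fin 2) M) : firstLeg (X.map φ) = (firstLeg X).map φ := by
    ext p r
    simp [firstLeg, apply_ite φ]
  have h₂ (X : Matrix (Fin 2) (Fin 2) M) : secondLeg (X.map φ) = (secondLeg X).map φ := by
    ext p r
    simp [secondLeg, apply_ite φ]
  unfold Exchange at *
  rw [h₁, h₂, ← Matrix.map_mul, ← Matrix.map_mul, h, Matrix.map_mul, Matrix.map_mul]

section Relations

variable {M : Type*} [Ring M] [Algebra ℂ M] {q x : ℂ} {S T : Matrix (Fin 2) (Fin 2) M}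

lemma Exchange.commute_B (h : Exchange ((sixVertex q x).map (algebraMap ℂ M)) S T)
    (hx : br (q * x) ≠ 0) : Commute (S 0 1) (T 0 1) := by
  have := congrFun (congrFun h (0, 0)) (1, 1)
  simp [firstLeg, secondLeg, Matrix.mul_apply, Fintype.sum_prod_type, sixVertex,
    Algebra.algebraMap_eq_smul_one] at this
  exact smul_right_injective M hx this

lemma Exchange.smul_A_mul_B (h : Exchange ((sixVertex q x).map (algebraMap ℂ M)) S T) :
    br x • (T 0 0 * S 0 1) = br (q * x) • (S 0 1 * T 0 0) - br q • (T 0 1 * S 0 0) := by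
  have := congrFun (congrFun h (0, 0)) (1, 0)
  simp [firstLeg, secondLeg, Matrix.mul_apply, Fintype.sum_prod_type, sixVertex,
    Algebra.algebraMap_eq_smul_one] at this
  rw [this]
  abel

lemma Exchange.smul_D_mul_B (h : Exchange ((sixVertex q x).map (algebraMap ℂ M)) S T) :
    br x • (S 1 1 * T 0 1) = br (q * x) • (T 0 1 * S 1 1) - br q • (S 0 1 * T 1 1) := by
  have := congrFun (congrFun h (1, 0)) (1, 1)
  simp [firstLeg, secondLeg, Matrix.mul_apply, Fintype.sum_prod_type, sixVertex,
    Algebra.algebraMap_eq_smul_one] at this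
  rw [← this]
  abel

end Relations

/-- The 2×2 block form of a partial monodromy matrix, over the sites listed in `l`. -/
def chain (q c : ℂ) {N : ℕ} (w : Fin N → ℂ) (z : ℂ) (l : List (Fin N)) :
    Matrix (Fin 2) (Fin 2) (Matrix (Fin N → Fin 3) (Fin N → Fin 3) ℂ) :=
  (l.map fun j => (lax q c (q⁻¹ * z / w j)).map (siteOp j)).prod

lemma chain_cons (q c : ℂ) {N : ℕ} (w : Fin N → ℂ) (z : ℂ) (j : Fin N) (l : List (Fin N)) :
    chain q c w z (j :: l) = (lax q c (q⁻¹ * z / w j)).map (siteOp j) * chain q c w z l := by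
  simp [chain]

lemma monodromy_eq_chain (q c : ℂ) {N : ℕ} (w : Fin N → ℂ) (z : ℂ) :
    (Matrix.compRingEquiv (Fin 2) (Fin N → Fin 3) ℂ).symm (monodromy q c w z) =
      chain q c w z (List.finRange N).reverse := by
  rw [monodromy, map_list_prod, List.map_map]
  rfl

lemma commute_siteOp_chain (q c : ℂ) {N : ℕ} (w : Fin N → ℂ) (z : ℂ) {i : Fin N}
    {l : List (Fin N)} (hi : i ∉ l) (X : Matrix (Fin 3) (Fin 3) ℂ) (a b : Fin 2) :
    Commute (siteOp i X) (chain q c w z l a b) := by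
  induction l generalizing a b with
  | nil =>
    rw [chain, List.map_nil, List.prod_nil, Matrix.one_apply]
    split_ifs
    · exact Commute.one_right _
    · exact Commute.zero_right _
  | cons j l ih =>
    obtain ⟨hij, hl⟩ : i ≠ j ∧ i ∉ l := by simpa using hi
    rw [chain_cons, Matrix.mul_apply]
    exact Commute.sum_right _ _ _ fun k _ => (commute_siteOp hij _ _).mul_right (ih hl k b)

lemma exchange_chain {q c : ℂ} (hq : q ≠ 0) (hc : c ^ 2 = br q * br (q ^ 2)) {N : ℕ}
    {w : Fin N → ℂ} (hw : ∀ j, w j ≠ 0) {z z' : ℂ} (hz : z ≠ 0) (hz' : z' ≠ 0)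
    {l : List (Fin N)} (hl : l.Nodup) :
    Exchange ((sixVertex q (z / z')).map (algebraMap ℂ _)) (chain q c w z l)
      (chain q c w z' l) := by
  induction l with
  | nil => simp [Exchange, chain]
  | cons j l ih =>
    obtain ⟨hj, hl⟩ := List.nodup_cons.1 hl
    rw [chain_cons, chain_cons]
    have hdiv : z / z' = (q⁻¹ * z / w j) / (q⁻¹ * z' / w j) := by
      have := hw j
      field_simp
    refine Exchange.mul ?_ (ih hl) (fun _ _ _ _ => commute_siteOp_chain q c w z' hj _ _ _)
      (fun _ _ _ _ => (commute_siteOp_chain q c w z hj _ _ _).symm)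
    have h := (exchange_lax hq hc (y := q⁻¹ * z / w j) (y' := q⁻¹ * z' / w j)
      (by simp [hq, hz, hw]) (by simp [hq, hz', hw])).map (siteOp j).toRingHom
    rw [hdiv]
    convert h using 1
    · ext p r : 2
      simp
    · rfl
    · rfl

lemma chain_mulVec_vac {q : ℂ} (hq : q ≠ 0) (c : ℂ) {N : ℕ} (w : Fin N → ℂ) (z : ℂ)
    {l : List (Fin N)} (hl : l.Nodup) :
    chain q c w z l 0 0 *ᵥ vac N = (l.map fun j => br (q * (z / w j))).prod • vac N ∧
    chain q c w z l 1 0 *ᵥ vac N = 0 ∧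
    chain q c w z l 1 1 *ᵥ vac N = (l.map fun j => br (q⁻¹ * (z / w j))).prod • vac N := by
  induction l with
  | nil => simp [chain]
  | cons j l ih =>
    obtain ⟨hj, hl⟩ := List.nodup_cons.1 hl
    obtain ⟨hA, hC, hD⟩ := ih hl
    have h₀ : siteOp j (lax q c (q⁻¹ * z / w j) 0 0) *ᵥ vac N = br (q * (z / w j)) • vac N :=
      siteOp_mulVec_vac j (by simp [lax, R12]; congr 1; field_simp) (by simp [lax, R12])
        (by simp [lax, R12])
    have h₁ : siteOp j (lax q c (q⁻¹ * z / w j) 1 0) *ᵥ vac N = (0 : ℂ) • vac N :=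
      siteOp_mulVec_vac j (by simp [lax, R12]) (by simp [lax, R12]) (by simp [lax, R12])
    have h₂ : siteOp j (lax q c (q⁻¹ * z / w j) 1 1) *ᵥ vac N = br (q⁻¹ * (z / w j)) • vac N :=
      siteOp_mulVec_vac j (by simp [lax, R12]; congr 1; ring) (by simp [lax, R12])
        (by simp [lax, R12])
    have hcomm := (commute_siteOp_chain q c w z hj (lax q c (q⁻¹ * z / w j) 1 0) 0 1).eq
    simp only [chain_cons, Matrix.mul_apply, Fin.sum_univ_two, Matrix.map_apply,
      Matrix.add_mulVec, List.map_cons, List.prod_cons]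
    refine ⟨?_, ?_, ?_⟩
    · simp [← Matrix.mulVec_mulVec, hA, hC, h₀, Matrix.mulVec_smul, smul_smul]
      rw [mul_comm]
    · simp [← Matrix.mulVec_mulVec, hA, hC, h₁, Matrix.mulVec_smul]
    · rw [hcomm]
      simp [← Matrix.mulVec_mulVec, hD, h₁, h₂, Matrix.mulVec_smul, smul_smul]
      rw [mul_comm]

lemma bethe_action {K V P : Type*} [Field K] [AddCommGroup V] [Module K V] [DecidableEq P]
    {A B : P → Module.End K V} {a : P → K} {f g : P → P → K} {v : V}
    (hv : ∀ p, A p v = a p • v)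
    (hAB : ∀ p r, p ≠ r → A p * B r = f p r • (B r * A p) + g p r • (B p * A r))
    (hBB : ∀ p r, Commute (B p) (B r))
    (hfg : ∀ p r s, p ≠ r → p ≠ s → r ≠ s →
      f p r * g p s + g p r * g r s = g p s * f s r)
    (l : List P) (hl : l.Nodup) (p : P) (hp : p ∉ l) :
    A p ((l.map B).prod v) = (a p * (l.map (f p)).prod) • (l.map B).prod v +
      (l.map fun j => (a j * g p j * ((l.erase j).map (f j)).prod) •
        B p (((l.erase j).map B).prod v)).sum := by
  induction l generalizing p with
  | nil => simp [hv]
  | cons r l ih =>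
    obtain ⟨hr, hl⟩ := List.nodup_cons.1 hl
    obtain ⟨hpr, hpl⟩ : p ≠ r ∧ p ∉ l := by simpa using hp
    have key : (l.map fun j => (a j * g p j * (((r :: l).erase j).map (f j)).prod) •
          B p ((((r :: l).erase j).map B).prod v)).sum =
        f p r • B r ((l.map fun j => (a j * g p j * ((l.erase j).map (f j)).prod) •
          B p (((l.erase j).map B).prod v)).sum) +
        g p r • B p ((l.map fun j => (a j * g r j * ((l.erase j).map (f j)).prod) •
          B r (((l.erase j).map B).prod v)).sum) := by
      rw [map_list_sum, map_list_sum, List.smul_sum, List.smul_sum, List.map_map, List.map_map,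
        List.map_map, List.map_map, ← List.sum_map_add]
      refine congrArg List.sum (List.map_congr_left fun j hj => ?_)
      have hrj : r ≠ j := fun h => hr (h ▸ hj)
      have hpj : p ≠ j := fun h => hpl (h ▸ hj)
      have e : (r :: l).erase j = r :: l.erase j := by
        simp [hrj]
      have hc : B r (B p (((l.erase j).map B).prod v)) = B p (B r (((l.erase j).map B).prod v)) :=
        LinearMap.congr_fun (hBB r p).eq _
      simp only [e, Function.comp, List.map_cons, List.prod_cons, Module.End.mul_apply, map_smul,
        smul_smul, hc, ← add_smul]
      congr 1
      linear_combination (-(a j) * (List.map (f j) (l.erase j)).prod) * hfg p r j hpr hpj hrj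
    have h := LinearMap.congr_fun (hAB p r hpr) ((l.map B).prod v)
    simp only [Module.End.mul_apply, LinearMap.add_apply, LinearMap.smul_apply] at h
    rw [List.map_cons, List.map_cons, List.map_cons, List.prod_cons, List.prod_cons, List.sum_cons,
      key, Module.End.mul_apply, h, ih hl p hpl, ih hl r hr]
    simp only [List.erase_cons_head, map_add, smul_add, map_smul, smul_smul]
    rw [show f p r * (a p * (l.map (f p)).prod) = a p * (f p r * (l.map (f p)).prod) by ring,
      show g p r * (a r * (l.map (f r)).prod) = a r * g p r * (l.map (f r)).prod by ring]
    abel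


lemma br_inv (x : ℂ) : br x⁻¹ = -br x := by simp [br]

lemma notMem_erase_self {P : Type*} [DecidableEq P] {l : List P} (hl : l.Nodup) (j : P) :
    j ∉ l.erase j :=
  hl.not_mem_erase

lemma br_div {x y : ℂ} (hx : x ≠ 0) (hy : y ≠ 0) : br (x / y) = (x ^ 2 - y ^ 2) / (x * y) := by
  unfold br
  field_simp

lemma br_mul_div {q x y : ℂ} (hq : q ≠ 0) (hx : x ≠ 0) (hy : y ≠ 0) :
    br (q * (x / y)) = (q ^ 2 * x ^ 2 - y ^ 2) / (q * x * y) := by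
  unfold br
  field_simp

lemma br_inv_mul_div {q x y : ℂ} (hq : q ≠ 0) (hx : x ≠ 0) (hy : y ≠ 0) :
    br (q⁻¹ * (x / y)) = (x ^ 2 - q ^ 2 * y ^ 2) / (q * x * y) := by
  unfold br
  field_simp

lemma Aop_mulVec_bethe_eq_Dop_mulVec_bethe {q c : ℂ} (hq : q ≠ 0)
    (hc : c ^ 2 = br q * br (q ^ 2)) {N : ℕ} {u : Option (Fin N) → ℂ} (hu : ∀ p, u p ≠ 0)
    (hu₁ : ∀ p r, p ≠ r → u p ^ 2 ≠ u r ^ 2) (hu₂ : ∀ p r, p ≠ r → q ^ 2 * u p ^ 2 ≠ u r ^ 2) :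
    Aop q c (fun j => u (some j)) (u none) *ᵥ bethe q c (fun j => u (some j)) =
      Dop q c (fun j => u (some j)) (u none) *ᵥ bethe q c (fun j => u (some j)) := by
  set w : Fin N → ℂ := fun j => u (some j) with hw
  set l₀ := (List.finRange N).reverse with hl₀
  have hn₀ : l₀.Nodup := List.nodup_reverse.2 (List.nodup_finRange N)
  set l : List (Option (Fin N)) := (List.finRange N).map some with hl
  have hn : l.Nodup := (List.nodup_finRange N).map (Option.some_injective _)
  set T := fun p => chain q c w (u p) l₀
  let E := Matrix.toLinAlgEquiv' (R := ℂ) (n := Fin N → Fin 3)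
  let f : Option (Fin N) → Option (Fin N) → ℂ := fun p r => br (q * (u r / u p)) / br (u r / u p)
  let g : Option (Fin N) → Option (Fin N) → ℂ := fun p r => -(br q / br (u r / u p))
  have hd : ∀ p r, p ≠ r → u p ^ 2 - u r ^ 2 ≠ 0 := fun p r h => sub_ne_zero.2 (hu₁ p r h)
  have hbr : ∀ p r, p ≠ r → br (u p / u r) ≠ 0 := fun p r h => by
    rw [br_div (hu p) (hu r)]
    exact div_ne_zero (hd p r h) (mul_ne_zero (hu p) (hu r))
  have hex (p r) : Exchange ((sixVertex q (u p / u r)).map (algebraMap ℂ _)) (T p) (T r) :=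
    exchange_chain hq hc (fun j => hu _) (hu p) (hu r) hn₀
  have hBB (p r) : Commute (E (T p 0 1)) (E (T r 0 1)) := by
    rcases eq_or_ne p r with rfl | h
    · exact Commute.refl _
    · refine Commute.map ((hex p r).commute_B ?_) E
      rw [br_mul_div hq (hu p) (hu r)]
      exact div_ne_zero (sub_ne_zero.2 (hu₂ p r h))
        (mul_ne_zero (mul_ne_zero hq (hu p)) (hu r))
  have hAB (p r) (h : p ≠ r) : E (T p 0 0) * E (T r 0 1) =
      f p r • (E (T r 0 1) * E (T p 0 0)) + g p r • (E (T p 0 1) * E (T r 0 0)) := by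
    simp only [← map_mul, ← map_smul, ← map_add]
    congr 1
    refine smul_right_injective _ (hbr r p h.symm) ?_
    simp only [(hex r p).smul_A_mul_B, smul_add, smul_smul, f, g, smul_neg, neg_smul,
      mul_div_cancel₀ _ (hbr r p h.symm)]
    abel
  have hDB (p r) (h : p ≠ r) : E (T p 1 1) * E (T r 0 1) =
      f r p • (E (T r 0 1) * E (T p 1 1)) + g r p • (E (T p 0 1) * E (T r 1 1)) := by
    simp only [← map_mul, ← map_smul, ← map_add]
    congr 1
    refine smul_right_injective _ (hbr p r h) ?_
    simp only [(hex p r).smul_D_mul_B, smul_add, smul_smul, f, g, smul_neg, neg_smul,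
      mul_div_cancel₀ _ (hbr p r h)]
    abel
  have hA (p) : E (T p 0 0) (vac N) = (l.map fun k => br (q * (u p / u k))).prod • vac N := by
    rw [hl, List.map_map, ← List.prod_reverse, ← List.map_reverse]
    exact (chain_mulVec_vac hq c w (u p) hn₀).1
  have hD (p) : E (T p 1 1) (vac N) = (l.map fun k => br (q⁻¹ * (u p / u k))).prod • vac N := by
    rw [hl, List.map_map, ← List.prod_reverse, ← List.map_reverse]
    exact (chain_mulVec_vac hq c w (u p) hn₀).2.2
  have hnone : none ∉ l := by simp [hl]
  have hfg (p r s) (hpr : p ≠ r) (hps : p ≠ s) (hrs : r ≠ s) :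
      f p r * g p s + g p r * g r s = g p s * f s r := by
    have h₁ := hd r p hpr.symm
    have h₂ := hd s p hps.symm
    have h₃ := hd r s hrs
    have h₄ := hd s r hrs.symm
    have := hu p
    have := hu r
    have := hu s
    simp only [f, g, br_div (hu _) (hu _), br_mul_div hq (hu _) (hu _)]
    rw [show u s ^ 2 - u r ^ 2 = -(u r ^ 2 - u s ^ 2) by ring]
    unfold br
    field_simp
    ring
  have hg (p r) : g p r = - g r p := by
    simp only [g, br_div (hu _) (hu _)]
    rw [show u r ^ 2 - u p ^ 2 = -(u p ^ 2 - u r ^ 2) by ring, mul_comm (u r), neg_div, div_neg]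
  have hfg' (p r s) (hpr : p ≠ r) (hps : p ≠ s) (hrs : r ≠ s) :
      f r p * g s p + g r p * g s r = g s p * f r s := by
    have h₁ := hd r p hpr.symm
    have h₂ := hd p s hps
    have h₃ := hd s r hrs.symm
    have h₄ := hd p r hpr
    have := hu p
    have := hu r
    have := hu s
    simp only [f, g, br_div (hu _) (hu _), br_mul_div hq (hu _) (hu _)]
    rw [show u r ^ 2 - u s ^ 2 = -(u s ^ 2 - u r ^ 2) by ring]
    unfold br
    field_simp
    ring
  have hfac (p r) (h : p ≠ r) :
      br (q * (u p / u r)) * f p r = br (q⁻¹ * (u p / u r)) * f r p := by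
    have h₁ := hd p r h
    have := hu p
    have := hu r
    simp only [f, br_div (hu _) (hu _), br_mul_div hq (hu _) (hu _),
      br_inv_mul_div hq (hu _) (hu _)]
    rw [show u r ^ 2 - u p ^ 2 = -(u p ^ 2 - u r ^ 2) by ring]
    field_simp
    ring
  have hprod {p} {m : List (Option (Fin N))} (hm : p ∉ m) :
      (m.map fun k => br (q * (u p / u k))).prod * (m.map (f p)).prod =
        (m.map fun k => br (q⁻¹ * (u p / u k))).prod * (m.map fun k => f k p).prod := by
    rw [← List.prod_map_mul, ← List.prod_map_mul]
    exact congrArg List.prod <| List.map_congr_left fun k hk => hfac p k fun h => hm (h ▸ hk)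
  have hΨ : bethe q c w = (l.map fun p => E (T p 0 1)).prod (vac N) := by
    have : (l.map fun p => E (T p 0 1)).prod =
        E ((List.finRange N).map fun j => Bop q c w (w j)).prod := by
      rw [map_list_prod, hl, List.map_map, List.map_map]
      refine congrArg List.prod (List.map_congr_left fun j _ => ?_)
      simp only [Function.comp, T, ← monodromy_eq_chain, hl₀]
      rfl
    rw [this]
    rfl
  have hAop : Aop q c w (u none) = T none 0 0 := by
    simp only [T, ← monodromy_eq_chain, hl₀]; rfl
  have hDop : Dop q c w (u none) = T none 1 1 := by
    simp only [T, ← monodromy_eq_chain, hl₀]; rfl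
  rw [hAop, hDop, hΨ]
  change E (T none 0 0) _ = E (T none 1 1) _
  rw [bethe_action hA hAB hBB hfg l hn none hnone,
    bethe_action (f := fun p r => f r p) (g := fun p r => g r p) hD hDB hBB hfg' l hn none hnone,
    hprod hnone]
  congr 2
  refine List.map_congr_left fun j hj => ?_
  congr 1
  have hjj : u j / u j = 1 := div_self (hu j)
  rw [← List.prod_map_erase _ hj, ← List.prod_map_erase (fun k => br (q⁻¹ * (u j / u k))) hj, hjj,
    mul_one, mul_one, br_inv, hg none j]
  linear_combination (-br q * g j none) * hprod (notMem_erase_self hn j)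

lemma subsingleton_mul_exp_eq {a b m n : ℝ} (ha : 0 < a) (hb : 0 < b) (hmn : m ≠ n) :
    {t : ℝ | a * Real.exp (m * t) = b * Real.exp (n * t)}.Subsingleton := by
  have key {t : ℝ} (h : a * Real.exp (m * t) = b * Real.exp (n * t)) :
      (m - n) * t = Real.log b - Real.log a := by
    have := congrArg Real.log h
    rw [Real.log_mul ha.ne' (Real.exp_ne_zero _), Real.log_mul hb.ne' (Real.exp_ne_zero _),
      Real.log_exp, Real.log_exp] at this
    linarith
  intro s hs t ht
  exact mul_left_cancel₀ (sub_ne_zero.2 hmn) ((key hs).trans (key ht).symm)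

section Continuity

variable {X : Type*} [TopologicalSpace X] (q c : ℂ) {N : ℕ} {w : X → Fin N → ℂ} {z : X → ℂ}

lemma continuous_R12 {y : X → ℂ} (hq : q ≠ 0) (hy : Continuous y) (hy₀ : ∀ t, y t ≠ 0)
    (p r : Fin 2 × Fin 3) : Continuous fun t => R12 q c (y t) p r := by
  have hbr {k : ℂ} (hk : k ≠ 0) : Continuous fun t => br (k * y t) :=
    (continuous_const.mul hy).sub
      ((continuous_const.mul hy).inv₀ fun t => mul_ne_zero hk (hy₀ t))
  have h₀ : Continuous fun t => br (y t) := by simpa using hbr one_ne_zero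
  have h₁ := hbr hq
  have h₂ := hbr (pow_ne_zero 2 hq)
  simp only [R12, Matrix.of_apply]
  repeat' refine continuous_if_const _ (fun _ => ?_) (fun _ => ?_)
  all_goals first | assumption | exact continuous_const

lemma continuous_monodromy (hq : q ≠ 0) (hw : Continuous w) (hw₀ : ∀ t j, w t j ≠ 0)
    (hz : Continuous z) (hz₀ : ∀ t, z t ≠ 0) :
    Continuous fun t => monodromy q c (w t) (z t) := by
  refine continuous_list_prod _ fun j _ => ?_
  refine continuous_matrix fun p r => ?_
  refine (continuous_R12 q c hq ?_ (fun t => ?_) _ _).mul continuous_const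
  · exact (continuous_const.mul hz).div ((continuous_apply j).comp hw) fun t => hw₀ t j
  · exact div_ne_zero (mul_ne_zero (inv_ne_zero hq) (hz₀ t)) (hw₀ t j)

lemma continuous_bethe (hq : q ≠ 0) (hw : Continuous w) (hw₀ : ∀ t j, w t j ≠ 0) :
    Continuous fun t => bethe q c (w t) := by
  refine Continuous.matrix_mulVec (continuous_list_prod _ fun j _ => ?_) continuous_const
  exact continuous_matrix fun σ τ => (continuous_monodromy q c hq hw hw₀
    ((continuous_apply j).comp hw) fun t => hw₀ t j).matrix_elem _ _

end Continuity

/-- For twist angle φ = π, the fundamental transfer matrix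
`T^{(1)}(z) = i(𝒜(z) − 𝒟(z))` annihilates the Bethe vector. -/
theorem stmt3 (q c : ℂ) (hq : q ≠ 0) (hc : c^2 = br q * br (q^2))
    (N : ℕ) (hN : 1 ≤ N) (w : Fin N → ℂ) (hw : ∀ j, w j ≠ 0)
    (z : ℂ) (hz : z ≠ 0) :
    (Complex.I • (Aop q c w z - Dop q c w z)).mulVec (bethe q c w) = 0 := by

  let u₀ : Option (Fin N) → ℂ := fun p => p.elim z w
  let m : Option (Fin N) → ℝ := fun p => p.elim 0 fun j => (j : ℝ) + 1
  let u : ℝ → Option (Fin N) → ℂ := fun t p => u₀ p * (Real.exp (m p * t) : ℝ)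
  have hu₀ (p) : u₀ p ≠ 0 := by cases p <;> simp [u₀, hz, hw]
  have hu (t p) : u t p ≠ 0 :=
    mul_ne_zero (hu₀ p) (Complex.ofReal_ne_zero.2 (Real.exp_ne_zero _))
  have hm {p r} (h : p ≠ r) : m p ≠ m r := by
    have pos (j : Fin N) : (j : ℝ) + 1 ≠ 0 := by positivity
    cases p <;> cases r <;> simp_all [m, Fin.ext_iff, eq_comm]
  have hnorm (t p) : ‖u t p‖ = ‖u₀ p‖ * Real.exp (m p * t) := by
    rw [norm_mul, Complex.norm_real, Real.norm_of_nonneg (Real.exp_pos _).le]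
  let bad (κ : ℝ) (p r : Option (Fin N)) : Set ℝ :=
    {t | p ≠ r ∧ κ * ‖u₀ p‖ * Real.exp (m p * t) = ‖u₀ r‖ * Real.exp (m r * t)}
  have hbad {κ : ℝ} (hκ : 0 < κ) (p r) : (bad κ p r).Finite := by
    refine Set.Subsingleton.finite fun s hs t ht => ?_
    exact subsingleton_mul_exp_eq (mul_pos hκ (norm_pos_iff.2 (hu₀ p))) (norm_pos_iff.2 (hu₀ r))
      (hm hs.1) hs.2 ht.2
  have hfin : ((⋃ p, ⋃ r, bad 1 p r) ∪ ⋃ p, ⋃ r, bad ‖q‖ p r).Finite :=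
    (Set.finite_iUnion fun p => Set.finite_iUnion fun r => hbad one_pos p r).union
      (Set.finite_iUnion fun p => Set.finite_iUnion fun r => hbad (norm_pos_iff.2 hq) p r)
  have hcont (p) : Continuous fun t => u t p := by
    simp only [u]
    fun_prop
  have hcontw : Continuous fun t j => u t (some j) := continuous_pi fun j => hcont _
  have hmon := continuous_monodromy q c hq hcontw (fun t j => hu t _) (hcont none) (hu · none)
  have hbethe := continuous_bethe q c hq hcontw (fun t j => hu t _)
  have key := Continuous.ext_on (hfin.countable.dense_compl ℝ)
    (f := fun t => Aop q c (fun j => u t (some j)) (u t none) *ᵥ bethe q c fun j => u t (some j))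
    (g := fun t => Dop q c (fun j => u t (some j)) (u t none) *ᵥ bethe q c fun j => u t (some j))
    ((continuous_matrix fun σ τ => hmon.matrix_elem _ _).matrix_mulVec hbethe)
    ((continuous_matrix fun σ τ => hmon.matrix_elem _ _).matrix_mulVec hbethe)
    (fun t ht => by
      simp only [Set.mem_compl_iff, Set.mem_union, Set.mem_iUnion, not_or, not_exists] at ht
      refine Aop_mulVec_bethe_eq_Dop_mulVec_bethe hq hc (hu t) (fun p r h e => ht.1 p r ⟨h, ?_⟩)
        (fun p r h e => ht.2 p r ⟨h, ?_⟩)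
      · rw [one_mul, ← hnorm, ← hnorm]
        refine (pow_left_inj₀ (norm_nonneg _) (norm_nonneg _) two_ne_zero).1 ?_
        rw [← norm_pow, e, norm_pow]
      · rw [mul_assoc, ← hnorm, ← hnorm, ← norm_mul]
        refine (pow_left_inj₀ (norm_nonneg _) (norm_nonneg _) two_ne_zero).1 ?_
        rw [← norm_pow, mul_pow, e, norm_pow])
  have h₀ := congrFun key 0
  simp only [u, u₀, mul_zero, Real.exp_zero, Complex.ofReal_one, mul_one, Option.elim] at h₀
  rw [Matrix.smul_mulVec, Matrix.sub_mulVec, h₀, sub_self, smul_zero]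

end
end

section
/- All components of the Bethe vector |Ψ(w₁,…,w_N)⟩ are divisible by the product ∏_{1≤j<k≤N}[q w_j/w_k]: for each σ ∈ {⇑,0,⇓}^N there exists a Laurent polynomial P_σ ∈ ℂ[w₁^{±1},…,w_N^{±1}] (in general depending on c) such that for all nonzero w₁,…,w_N the component ⟨σ|Ψ(w₁,…,w_N)⟩ equals (∏_{1≤j<k≤N}[q w_j/w_k]) · P_σ(w₁,…,w_N). -/
open Matrix BigOperators Finset

noncomputable section

/-- The operator on ℂ² obtained from `R12` by fixing the states of the site. -/
def siteBlock (q c u : ℂ) (s t : Fin 3) : Matrix (Fin 2) (Fin 2) ℂ :=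
  Matrix.of fun a b => R12 q c u (a, s) (b, t)

/-- Two superposed copies of `siteBlock`, summed over the intermediate state of the site. -/
def doubleBlock (q c u v : ℂ) (s t : Fin 3) : Matrix (Fin 2 × Fin 2) (Fin 2 × Fin 2) ℂ :=
  ∑ r, kroneckerMap (· * ·) (siteBlock q c u s r) (siteBlock q c v r t)

/-- The braided six-vertex R-matrix. -/
def braidR (q x : ℂ) : Matrix (Fin 2 × Fin 2) (Fin 2 × Fin 2) ℂ :=
  Matrix.of fun p p' =>
    if p.1 = p.2 then (if p = p' then br (q * x) else 0)
    else if p = p' then br q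
    else if p = p'.swap then br x
    else 0

set_option maxHeartbeats 4000000 in
lemma braidR_mul_doubleBlock {q c x v : ℂ} (hq : q ≠ 0) (hx : x ≠ 0) (hv : v ≠ 0)
    (hc : c^2 = br q * br (q^2)) (s t : Fin 3) :
    braidR q x * doubleBlock q c (x * v) v s t = doubleBlock q c v (x * v) s t * braidR q x := by
  have hc' : c * c = br q * br (q^2) := by rw [← hc, sq]
  ext ⟨a, b⟩ ⟨a', b'⟩
  fin_cases s <;> fin_cases t <;> fin_cases a <;> fin_cases b <;> fin_cases a' <;> fin_cases b' <;>
    simp [Matrix.mul_apply, Fintype.sum_prod_type, doubleBlock, siteBlock, braidR, R12,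
      Fin.sum_univ_three, hc', kroneckerMap_apply] <;>
    simp only [br] <;> field_simp <;> ring1

lemma doubleBlock_mulVec_symm {q c u ε : ℂ} (hq : q ≠ 0) (hu : u ≠ 0) (hε : ε = 1 ∨ ε = -1)
    (hc : c^2 = br q * br (q^2)) (s : Fin 3) {x : Fin 2 × Fin 2 → ℂ}
    (hx : x (0, 1) = ε * x (1, 0)) :
    (doubleBlock q c u (ε * q * u) s 0 *ᵥ x) (0, 1) =
      ε * (doubleBlock q c u (ε * q * u) s 0 *ᵥ x) (1, 0) := by
  have hc' : c * c = br q * br (q^2) := by rw [← hc, sq]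
  rcases hε with rfl | rfl <;> fin_cases s <;>
    simp [Matrix.mulVec, dotProduct, Fintype.sum_prod_type, doubleBlock, siteBlock, R12,
      Fin.sum_univ_three, kroneckerMap_apply, hx, hc'] <;>
    simp only [br] <;> field_simp <;> first | ring1 | simp

lemma doubleBlock_mulVec_up_of_symm {q c ε : ℂ} (hq : q ≠ 0) (hε : ε = 1 ∨ ε = -1)
    (hc : c^2 = br q * br (q^2)) (s : Fin 3) {x : Fin 2 × Fin 2 → ℂ}
    (hx : x (0, 1) = ε * x (1, 0)) {p : Fin 2 × Fin 2} (hp : p ≠ (0, 0)) :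
    (doubleBlock q c q⁻¹ ε s 0 *ᵥ x) p = 0 := by
  have hc' : c * c = br q * br (q^2) := by rw [← hc, sq]
  obtain ⟨a, b⟩ := p
  rcases hε with rfl | rfl <;> fin_cases s <;> fin_cases a <;> fin_cases b <;>
    simp [Matrix.mulVec, dotProduct, Fintype.sum_prod_type, doubleBlock, siteBlock, R12,
      Fin.sum_univ_three, kroneckerMap_apply, hx, hc'] at hp ⊢ <;>
    simp [br, hq] <;> field_simp <;> ring1

lemma doubleBlock_mulVec_up {q c u v : ℂ} (s : Fin 3) {x : Fin 2 × Fin 2 → ℂ}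
    (hx : ∀ p ≠ (0, 0), x p = 0) {p : Fin 2 × Fin 2} (hp : p ≠ (0, 0)) :
    (doubleBlock q c u v s 0 *ᵥ x) p = 0 := by
  have h1 := hx (0, 1) (by simp)
  have h2 := hx (1, 0) (by simp)
  have h3 := hx (1, 1) (by simp)
  obtain ⟨a, b⟩ := p
  fin_cases s <;> fin_cases a <;> fin_cases b <;>
    simp [Matrix.mulVec, dotProduct, Fintype.sum_prod_type, doubleBlock, siteBlock, R12,
      Fin.sum_univ_three, kroneckerMap_apply, h1, h2, h3] at hp ⊢

lemma doubleBlock_mulVec_eq_zero {q c u v : ℂ} (hu : br (q^2 * u) = 0) (s : Fin 3)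
    {x : Fin 2 × Fin 2 → ℂ} (hx : ∀ p ≠ (0, 0), x p = 0) :
    doubleBlock q c u v s 0 *ᵥ x = 0 := by
  have h1 := hx (0, 1) (by simp)
  have h2 := hx (1, 0) (by simp)
  have h3 := hx (1, 1) (by simp)
  ext ⟨a, b⟩
  fin_cases s <;> fin_cases a <;> fin_cases b <;>
    simp [Matrix.mulVec, dotProduct, Fintype.sum_prod_type, doubleBlock, siteBlock, R12,
      Fin.sum_univ_three, kroneckerMap_apply, h1, h2, h3, hu]

lemma list_prod_mulVec_induction {ι m : Type*} [Fintype m] [DecidableEq m]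
    (P : (m → ℂ) → Prop) (A : ι → Matrix m m ℂ) (l : List ι)
    (h : ∀ j ∈ l, ∀ x, P x → P (A j *ᵥ x)) {x : m → ℂ} (hx : P x) :
    P ((l.map A).prod *ᵥ x) := by
  induction l with
  | nil => simpa using hx
  | cons a l ih =>
    rw [List.map_cons, List.prod_cons, ← Matrix.mulVec_mulVec]
    exact h a (by simp) _ (ih fun j hj => h j (by simp [hj]))

lemma sum_list_prod_finRange_reverse {A : Type*} [Semiring A] {β : Type*} [Fintype β] (N : ℕ)
    (X : Fin N → β → A) :
    ∑ ρ : Fin N → β, ((List.finRange N).reverse.map fun j => X j (ρ j)).prod =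
      ((List.finRange N).reverse.map fun j => ∑ r, X j r).prod := by
  induction N with
  | zero => simp
  | succ n ih =>
    rw [← (Fin.consEquiv fun _ => β).sum_comp, Fintype.sum_prod_type_right]
    simp only [List.finRange_succ, List.reverse_cons, List.map_append, List.prod_append,
      ← List.map_reverse, List.map_map, Function.comp_def, Fin.consEquiv, Equiv.coe_fn_mk,
      Fin.cons_succ, Fin.cons_zero, List.map_cons, List.map_nil, List.prod_singleton,
      ← Finset.mul_sum, ← Finset.sum_mul]
    rw [ih]

lemma list_prod_kronecker {ι m n : Type*} [Fintype m] [DecidableEq m] [Fintype n] [DecidableEq n]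
    (A : ι → Matrix m m ℂ) (B : ι → Matrix n n ℂ) (l : List ι) :
    kroneckerMap (· * ·) (l.map A).prod (l.map B).prod =
      (l.map fun j => kroneckerMap (· * ·) (A j) (B j)).prod := by
  induction l with
  | nil => simp
  | cons a l ih => simp only [List.map_cons, List.prod_cons, Matrix.mul_kronecker_mul, ih]

lemma list_prod_R12at_apply {q c : ℂ} {N : ℕ} (u : Fin N → ℂ) (l : List (Fin N)) (hl : l.Nodup)
    (a b : Fin 2) (σ τ : Fin N → Fin 3) :
    (l.map fun j => R12at q c (u j) j).prod (a, σ) (b, τ) =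
      (l.map fun j => siteBlock q c (u j) (σ j) (τ j)).prod a b *
        if ∀ k ∉ l, σ k = τ k then 1 else 0 := by
  induction l generalizing a σ with
  | nil =>
    by_cases h : σ = τ
    · subst h; simp [Matrix.one_apply]
    · have : ¬ ∀ k, σ k = τ k := fun h' => h (funext h')
      simp [Matrix.one_apply, h, this]
  | cons j l ih =>
    obtain ⟨hj, hl⟩ := List.nodup_cons.1 hl
    simp only [List.map_cons, List.prod_cons, Matrix.mul_apply, Fintype.sum_prod_type,
      Finset.sum_mul]
    refine Finset.sum_congr rfl fun e _ => ?_
    rw [Finset.sum_eq_single (Function.update σ j (τ j))]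
    · rw [ih hl]
      have h1 : (l.map fun i => siteBlock q c (u i) (Function.update σ j (τ j) i) (τ i)) =
          l.map fun i => siteBlock q c (u i) (σ i) (τ i) := by
        refine List.map_congr_left fun i hi => ?_
        rw [Function.update_of_ne]
        rintro rfl
        exact hj hi
      have h2 : (∀ k ∉ l, Function.update σ j (τ j) k = τ k) ↔ ∀ k ∉ j :: l, σ k = τ k := by
        refine forall_congr' fun k => ?_
        by_cases hk : k = j
        · subst hk; simp
        · simp [hk]
      have h3 : ∀ k, k ≠ j → σ k = Function.update σ j (τ j) k := fun k hk => by
        rw [Function.update_of_ne hk]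
      rw [h1]
      simp only [h2, R12at, Matrix.of_apply, siteBlock, Function.update_self, if_pos h3]
      ring
    · intro ρ _ hρ
      rw [ih hl]
      simp only [R12at, Matrix.of_apply]
      by_cases h : ∀ k, k ≠ j → σ k = ρ k
      · rw [if_neg (c := ∀ k ∉ l, ρ k = τ k)]
        · simp
        · intro h'
          apply hρ
          ext k : 1
          by_cases hk : k = j
          · subst hk; simp [h' k hj]
          · simp [hk, h k hk]
      · rw [if_neg h]; simp
    · simp

lemma Bop_apply (q c : ℂ) {N : ℕ} (w : Fin N → ℂ) (z : ℂ) (σ τ : Fin N → Fin 3) :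
    Bop q c w z σ τ = ((List.finRange N).reverse.map fun j =>
      siteBlock q c (q⁻¹ * z / w j) (σ j) (τ j)).prod 0 1 := by
  simp only [Bop, Matrix.of_apply, monodromy]
  rw [list_prod_R12at_apply (fun j => q⁻¹ * z / w j) _
    (List.nodup_reverse.2 (List.nodup_finRange N))]
  simp

lemma Bop_mul_Bop_apply (q c : ℂ) {N : ℕ} (w : Fin N → ℂ) (y z : ℂ) (σ τ : Fin N → Fin 3) :
    (Bop q c w y * Bop q c w z) σ τ = ((List.finRange N).reverse.map fun j =>
      doubleBlock q c (q⁻¹ * y / w j) (q⁻¹ * z / w j) (σ j) (τ j)).prod (0, 0) (1, 1) := by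
  have h : ∀ ρ : Fin N → Fin 3, Bop q c w y σ ρ * Bop q c w z ρ τ =
      ((List.finRange N).reverse.map fun j => kroneckerMap (· * ·)
        (siteBlock q c (q⁻¹ * y / w j) (σ j) (ρ j))
        (siteBlock q c (q⁻¹ * z / w j) (ρ j) (τ j))).prod (0, 0) (1, 1) := by
    intro ρ
    rw [Bop_apply, Bop_apply, ← list_prod_kronecker]
    rfl
  simp only [Matrix.mul_apply, h]
  rw [← Matrix.sum_apply, sum_list_prod_finRange_reverse N fun j r => kroneckerMap (· * ·)
        (siteBlock q c (q⁻¹ * y / w j) (σ j) r) (siteBlock q c (q⁻¹ * z / w j) r (τ j))]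
  rfl

lemma sq_eq_one_of_br_eq_zero {z : ℂ} (hz : z ≠ 0) (h : br z = 0) : z^2 = 1 := by
  simp only [br] at h
  field_simp at h
  linear_combination h

lemma Bop_mul_Bop_of_br_ne_zero {q c : ℂ} (hq : q ≠ 0) (hc : c^2 = br q * br (q^2)) {N : ℕ}
    {w : Fin N → ℂ} (hw : ∀ j, w j ≠ 0) {y z : ℂ} (hy : y ≠ 0) (hz : z ≠ 0)
    (h : br (q * (y / z)) ≠ 0) : Bop q c w y * Bop q c w z = Bop q c w z * Bop q c w y := by
  ext σ τ
  rw [Bop_mul_Bop_apply, Bop_mul_Bop_apply]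
  have key : ∀ l : List (Fin N), braidR q (y / z) * (l.map fun j =>
        doubleBlock q c (q⁻¹ * y / w j) (q⁻¹ * z / w j) (σ j) (τ j)).prod =
      (l.map fun j => doubleBlock q c (q⁻¹ * z / w j) (q⁻¹ * y / w j) (σ j) (τ j)).prod *
        braidR q (y / z) := by
    intro l
    induction l with
    | nil => simp
    | cons j l ih =>
      have h1 : q⁻¹ * y / w j = y / z * (q⁻¹ * z / w j) := by field_simp
      have h2 := braidR_mul_doubleBlock (q := q) (c := c) (x := y / z) (v := q⁻¹ * z / w j) hq
        (div_ne_zero hy hz) (div_ne_zero (mul_ne_zero (inv_ne_zero hq) hz) (hw j)) hc (σ j) (τ j)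
      rw [← h1] at h2
      rw [List.map_cons, List.prod_cons, ← mul_assoc, h2, mul_assoc, ih, ← mul_assoc,
        List.map_cons, List.prod_cons]
  have h00 := congr_fun₂ (key (List.finRange N).reverse) (0, 0) (1, 1)
  simp only [Matrix.mul_apply, Fintype.sum_prod_type, Fin.sum_univ_two, braidR,
    Matrix.of_apply] at h00
  simp only [Prod.mk.injEq, zero_ne_one, one_ne_zero, Prod.swap_prod_mk, and_true, and_self,
    if_true, if_false, zero_mul, mul_zero, add_zero, zero_add, and_false] at h00
  exact mul_left_cancel₀ h (h00.trans (mul_comm _ _))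

lemma Bop_commute {q c : ℂ} (hq : q ≠ 0) (hq4 : q^4 ≠ 1) (hc : c^2 = br q * br (q^2)) {N : ℕ}
    {w : Fin N → ℂ} (hw : ∀ j, w j ≠ 0) {y z : ℂ} (hy : y ≠ 0) (hz : z ≠ 0) :
    Commute (Bop q c w y) (Bop q c w z) := by
  by_cases h : br (q * (y / z)) = 0
  · refine (Bop_mul_Bop_of_br_ne_zero hq hc hw hz hy fun h' => hq4 ?_).symm
    have h1 := sq_eq_one_of_br_eq_zero (mul_ne_zero hq (div_ne_zero hy hz)) h
    have h2 := sq_eq_one_of_br_eq_zero (mul_ne_zero hq (div_ne_zero hz hy)) h'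
    have h3 : q^4 = (q * (y / z))^2 * (q * (z / y))^2 := by field_simp
    rw [h3, h1, h2, one_mul]
  · exact Bop_mul_Bop_of_br_ne_zero hq hc hw hy hz h

lemma Bop_mul_Bop_vac {q c ε : ℂ} (hq : q ≠ 0) (hε : ε = 1 ∨ ε = -1)
    (hc : c^2 = br q * br (q^2)) {N : ℕ} {w : Fin N → ℂ} (hw : ∀ j, w j ≠ 0) {j k : Fin N}
    (hjk : j < k) (h : w k = ε * q * w j) :
    (Bop q c w (w j) * Bop q c w (w k)) *ᵥ vac N = 0 := by
  ext σ
  have hv : ((Bop q c w (w j) * Bop q c w (w k)) *ᵥ vac N) σ =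
      (Bop q c w (w j) * Bop q c w (w k)) σ fun _ => 0 := by
    simp [Matrix.mulVec, dotProduct, vac]
  rw [hv, Bop_mul_Bop_apply]
  have hε2 : ε * ε = 1 := by rcases hε with rfl | rfl <;> norm_num
  have hsort : (List.finRange N).Pairwise (· < ·) := List.pairwise_lt_finRange N
  obtain ⟨s, t, hst⟩ := List.append_of_mem (List.mem_finRange j)
  have hkt : k ∈ t := by
    have hk := List.mem_finRange k
    rw [hst] at hk hsort
    rcases List.mem_append.1 hk with hk | hk
    · exact absurd ((List.pairwise_append.1 hsort).2.2 k hk j (by simp)) (not_lt.2 hjk.le)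
    · exact (List.mem_cons.1 hk).resolve_left hjk.ne'
  obtain ⟨t₁, t₂, rfl⟩ := List.append_of_mem hkt
  set A : Fin N → Matrix (Fin 2 × Fin 2) (Fin 2 × Fin 2) ℂ := fun i =>
    doubleBlock q c (q⁻¹ * w j / w i) (q⁻¹ * w k / w i) (σ i) 0 with hA
  have hcol : ∀ M : Matrix (Fin 2 × Fin 2) (Fin 2 × Fin 2) ℂ,
      M (0, 0) (1, 1) = (M *ᵥ Pi.single (1, 1) 1) (0, 0) := fun M => by simp
  change ((List.finRange N).reverse.map A).prod (0, 0) (1, 1) = 0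
  refine (hcol _).trans ?_
  rw [hst]
  simp only [List.reverse_append, List.reverse_cons, List.map_append, List.prod_append,
    List.map_cons, List.map_nil, List.prod_singleton, ← Matrix.mulVec_mulVec, mul_assoc]
  have h1 := list_prod_mulVec_induction (fun x : Fin 2 × Fin 2 → ℂ => x (0, 1) = ε * x (1, 0))
    A s.reverse (fun i _ x hx => by
      have hu : q⁻¹ * w k / w i = ε * q * (q⁻¹ * w j / w i) := by rw [h]; ring
      simp only [hA, hu]
      exact doubleBlock_mulVec_symm hq
        (div_ne_zero (mul_ne_zero (inv_ne_zero hq) (hw j)) (hw i)) hε hc _ hx)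
    (x := Pi.single (1, 1) 1) (by simp)
  have h2 : ∀ p ≠ (0, 0), (A j *ᵥ ((s.reverse.map A).prod *ᵥ Pi.single (1, 1) 1)) p = 0 := by
    intro p hp
    have hu : q⁻¹ * w j / w j = q⁻¹ := mul_div_cancel_right₀ _ (hw j)
    have hv : q⁻¹ * w k / w j = ε := by
      have := hw j
      rw [h]; field_simp
    simp only [hA, hu, hv]
    exact doubleBlock_mulVec_up_of_symm hq hε hc _ h1 hp
  have h3 := list_prod_mulVec_induction (fun x : Fin 2 × Fin 2 → ℂ => ∀ p ≠ (0, 0), x p = 0)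
    A t₁.reverse (fun i _ x hx p hp => doubleBlock_mulVec_up _ hx hp) h2
  have h4 : br (q^2 * (q⁻¹ * w j / w k)) = 0 := by
    have hj := hw j
    rw [h]
    rcases hε with rfl | rfl
    · have : q^2 * (q⁻¹ * w j / (1 * q * w j)) = 1 := by field_simp
      rw [this]; simp [br]
    · have : q^2 * (q⁻¹ * w j / (-1 * q * w j)) = -1 := by field_simp
      rw [this]; norm_num [br]
  rw [doubleBlock_mulVec_eq_zero h4 _ h3]
  simp

lemma bethe_eq_zero {q c ε : ℂ} (hq : q ≠ 0) (hq4 : q^4 ≠ 1) (hε : ε = 1 ∨ ε = -1)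
    (hc : c^2 = br q * br (q^2)) {N : ℕ} {w : Fin N → ℂ} (hw : ∀ j, w j ≠ 0) {j k : Fin N}
    (hjk : j < k) (h : w k = ε * q * w j) : bethe q c w = 0 := by
  have hperm : (List.finRange N).Perm (((List.finRange N).erase j).erase k ++ [j, k]) := by
    refine (List.perm_cons_erase (List.mem_finRange j)).trans ?_
    refine ((List.perm_cons_erase ((List.mem_erase_of_ne hjk.ne').2
      (List.mem_finRange k))).cons j).trans ?_
    exact List.perm_append_comm (l₁ := [j, k])
  rw [bethe, (hperm.map _).prod_eq' (List.pairwise_map.2 (List.pairwise_of_forall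
    fun a b => Bop_commute hq hq4 hc hw (hw a) (hw b)))]
  simp only [List.map_append, List.prod_append, List.map_cons, List.map_nil, List.prod_cons,
    List.prod_nil, mul_one]
  rw [← Matrix.mulVec_mulVec, Bop_mul_Bop_vac hq hε hc hw hjk h, Matrix.mulVec_zero]

open MvPolynomial in
lemma X_sub_C_mul_X_dvd_iff {ι : Type*} [DecidableEq ι] {j k : ι} (hjk : j ≠ k) (a : ℂ)
    (p : MvPolynomial ι ℂ) :
    X k - C a * X j ∣ p ↔ aeval (Function.update X k (C a * X j) : ι → MvPolynomial ι ℂ) p = 0 := by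
  constructor
  · rintro ⟨r, rfl⟩
    simp [hjk, MvPolynomial.algebraMap_eq]
  · intro h
    have hhom : (Ideal.Quotient.mkₐ ℂ (Ideal.span {X k - C a * X j})).comp
        (aeval (Function.update X k (C a * X j) : ι → MvPolynomial ι ℂ)) =
        Ideal.Quotient.mkₐ ℂ (Ideal.span {X k - C a * X j}) := by
      refine MvPolynomial.algHom_ext fun i => ?_
      by_cases hi : i = k
      · subst hi
        simp only [AlgHom.comp_apply, aeval_X, Function.update_self]
        exact (Ideal.Quotient.eq.2 (Ideal.mem_span_singleton_self _)).symm
      · simp [hi]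
    have := DFunLike.congr_fun hhom p
    rw [AlgHom.comp_apply, h, map_zero] at this
    exact Ideal.mem_span_singleton.1 (Ideal.Quotient.eq_zero_iff_mem.1 this.symm)

open MvPolynomial in
lemma X_sub_C_mul_X_dvd_of_eval {ι : Type*} [DecidableEq ι] {j k : ι} (hjk : j ≠ k)
    {a : ℂ} {p : MvPolynomial ι ℂ} (h : ∀ w : ι → ℂ, w k = a * w j → eval w p = 0) :
    X k - C a * X j ∣ p := by
  rw [X_sub_C_mul_X_dvd_iff hjk]
  refine MvPolynomial.funext fun w => ?_
  have hw := h (Function.update w k (a * w j)) (by simp [hjk])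
  rw [map_zero, ← hw, ← MvPolynomial.coe_aeval_eq_eval, ← MvPolynomial.coe_aeval_eq_eval]
  simp only [RingHom.coe_coe]
  rw [← AlgHom.comp_apply]
  congr 1
  refine MvPolynomial.algHom_ext fun i => ?_
  by_cases hi : i = k
  · subst hi; simp
  · simp [hi]

open MvPolynomial in
lemma prime_X_sub_C_mul_X {ι : Type*} [DecidableEq ι] {j k : ι} (hjk : j ≠ k) (a : ℂ) :
    Prime (X k - C a * X j : MvPolynomial ι ℂ) := by
  refine ⟨fun h => ?_, fun h => ?_, fun p r h => ?_⟩
  · have := congrArg (eval (Pi.single k 1)) h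
    simp [hjk] at this
  · have := h.map (eval (0 : ι → ℂ))
    simp at this
  · rw [X_sub_C_mul_X_dvd_iff hjk, map_mul, mul_eq_zero] at h
    rwa [X_sub_C_mul_X_dvd_iff hjk, X_sub_C_mul_X_dvd_iff hjk]

open MvPolynomial in
lemma isRelPrime_X_sub_C_mul_X {N : ℕ} {j k j' k' : Fin N} (hjk : j < k) (hjk' : j' < k')
    {a a' : ℂ} (ha : a ≠ 0) (hne : ¬ (j = j' ∧ k = k' ∧ a = a')) :
    IsRelPrime (X k - C a * X j : MvPolynomial (Fin N) ℂ) (X k' - C a' * X j') := by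
  rw [(prime_X_sub_C_mul_X hjk.ne a).irreducible.isRelPrime_iff_not_dvd]
  rintro ⟨r, hr⟩
  have h : ∀ w : Fin N → ℂ, w k = a * w j → w k' = a' * w j' := fun w hw => by
    have := congrArg (eval w) hr
    simp only [map_sub, map_mul, eval_X, eval_C, hw, sub_self, zero_mul] at this
    exact sub_eq_zero.1 this
  have h1 := h (Pi.single k' 1)
  have h2 := h (fun i => if i = j then 1 else if i = k then a else 0)
  simp only [Pi.single_apply] at h1
  grind

/-- The functions that agree with a Laurent polynomial wherever all variables are nonzero. -/
def laurentFun (N : ℕ) : Subalgebra ℂ ((Fin N → ℂ) → ℂ) where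
  carrier := {f | ∃ (p : MvPolynomial (Fin N) ℂ) (d : Fin N → ℕ),
    ∀ w : Fin N → ℂ, (∀ j, w j ≠ 0) → f w = MvPolynomial.eval w p / ∏ j, w j ^ d j}
  mul_mem' := by
    rintro f g ⟨p, d, hf⟩ ⟨p', d', hg⟩
    refine ⟨p * p', d + d', fun w hw => ?_⟩
    simp only [Pi.mul_apply, hf w hw, hg w hw, map_mul, Pi.add_apply, pow_add,
      Finset.prod_mul_distrib]
    rw [div_mul_div_comm]
  add_mem' := by
    rintro f g ⟨p, d, hf⟩ ⟨p', d', hg⟩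
    refine ⟨p * ∏ j, MvPolynomial.X j ^ d' j + p' * ∏ j, MvPolynomial.X j ^ d j, d + d',
      fun w hw => ?_⟩
    have h1 : ∏ j, w j ^ d j ≠ 0 := Finset.prod_ne_zero_iff.2 fun j _ => pow_ne_zero _ (hw j)
    have h2 : ∏ j, w j ^ d' j ≠ 0 := Finset.prod_ne_zero_iff.2 fun j _ => pow_ne_zero _ (hw j)
    simp only [Pi.add_apply, hf w hw, hg w hw, map_add, map_mul, map_prod, map_pow,
      MvPolynomial.eval_X, pow_add, Finset.prod_mul_distrib]
    rw [div_add_div _ _ h1 h2]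
    ring
  algebraMap_mem' := fun a => ⟨MvPolynomial.C a, 0, fun w _ => by simp⟩

lemma eval_mem_laurentFun {N : ℕ} (p : MvPolynomial (Fin N) ℂ) :
    (fun w => MvPolynomial.eval w p) ∈ laurentFun N := ⟨p, 0, fun w _ => by simp⟩

lemma inv_mem_laurentFun {N : ℕ} (d : Fin N → ℕ) :
    (fun w : Fin N → ℂ => (∏ j, w j ^ d j)⁻¹) ∈ laurentFun N := ⟨1, d, fun w _ => by simp⟩

lemma const_mem_laurentFun {N : ℕ} (a : ℂ) : (fun _ => a) ∈ laurentFun N :=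
  (laurentFun N).algebraMap_mem a

lemma apply_mem_laurentFun {N : ℕ} (i : Fin N) : (fun w : Fin N → ℂ => w i) ∈ laurentFun N := by
  simpa using eval_mem_laurentFun (MvPolynomial.X i : MvPolynomial (Fin N) ℂ)

lemma inv_apply_mem_laurentFun {N : ℕ} (i : Fin N) :
    (fun w : Fin N → ℂ => (w i)⁻¹) ∈ laurentFun N := by
  convert inv_mem_laurentFun (Pi.single i 1 : Fin N → ℕ) using 3 with w
  simp [Pi.single_apply, pow_ite]

lemma br_mem_laurentFun {N : ℕ} (a : ℂ) (i j : Fin N) {f : (Fin N → ℂ) → ℂ}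
    (hf : ∀ w, f w = a * (w i / w j)) : (fun w => br (f w)) ∈ laurentFun N := by
  have h1 := mul_mem (const_mem_laurentFun a) (mul_mem (apply_mem_laurentFun i)
    (inv_apply_mem_laurentFun j))
  have h2 := mul_mem (const_mem_laurentFun a⁻¹) (mul_mem (apply_mem_laurentFun j)
    (inv_apply_mem_laurentFun i))
  convert sub_mem h1 h2 using 1
  ext w
  simp only [hf, br, Pi.sub_apply, Pi.mul_apply, mul_inv, inv_inv, div_eq_mul_inv]
  ring

lemma list_prod_apply_mem {W ι m : Type*} [Fintype m] [DecidableEq m] (S : Subalgebra ℂ (W → ℂ))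
    (F : ι → W → Matrix m m ℂ) (hF : ∀ i a b, (fun w => F i w a b) ∈ S) (l : List ι) (a b : m) :
    (fun w => (l.map fun i => F i w).prod a b) ∈ S := by
  induction l generalizing a with
  | nil =>
    simp only [List.map_nil, List.prod_nil]
    exact S.algebraMap_mem ((1 : Matrix m m ℂ) a b)
  | cons i l ih =>
    simp only [List.map_cons, List.prod_cons, Matrix.mul_apply]
    convert sum_mem (S := S) (t := Finset.univ) fun e _ => mul_mem (hF i a e) (ih e) using 1
    ext w
    simp [Finset.sum_apply]

lemma siteBlock_mem_laurentFun (q c : ℂ) {N : ℕ} (i j : Fin N) (s t : Fin 3) (a b : Fin 2) :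
    (fun w : Fin N → ℂ => siteBlock q c (q⁻¹ * w i / w j) s t a b) ∈ laurentFun N := by
  have hbr : ∀ a : ℂ, (fun w : Fin N → ℂ => br (a * (q⁻¹ * w i / w j))) ∈ laurentFun N :=
    fun a => br_mem_laurentFun (a * q⁻¹) i j fun w => by ring
  have h2 := hbr (q^2)
  have h1 := hbr q
  have h0 : (fun w : Fin N → ℂ => br (q⁻¹ * w i / w j)) ∈ laurentFun N :=
    br_mem_laurentFun q⁻¹ i j fun w => by ring
  have hc := const_mem_laurentFun (N := N) c
  have hz := const_mem_laurentFun (N := N) 0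
  have hite : ∀ (P : Prop) [Decidable P] {f g : (Fin N → ℂ) → ℂ}, f ∈ laurentFun N →
      g ∈ laurentFun N → (fun w => if P then f w else g w) ∈ laurentFun N := by
    intro P _ f g hf hg
    by_cases hP : P <;> simpa [hP]
  simp only [siteBlock, R12, Matrix.of_apply]
  exact hite _ h2 <| hite _ h1 <| hite _ h0 <| hite _ h0 <| hite _ h1 <| hite _ h2 <|
    hite _ hc <| hite _ hc <| hite _ hc <| hite _ hc hz

lemma bethe_mem_laurentFun (q c : ℂ) {N : ℕ} (σ : Fin N → Fin 3) :
    (fun w : Fin N → ℂ => bethe q c w σ) ∈ laurentFun N := by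
  have h : ∀ w : Fin N → ℂ, bethe q c w σ =
      ((List.finRange N).map fun j => Bop q c w (w j)).prod σ fun _ => 0 := fun w => by
    simp [bethe, Matrix.mulVec, dotProduct, vac]
  simp only [h]
  refine list_prod_apply_mem _ (fun j w => Bop q c w (w j)) (fun i a b => ?_) _ _ _
  simp only [Bop_apply]
  refine list_prod_apply_mem (laurentFun N)
    (fun j w => siteBlock q c (q⁻¹ * w i / w j) (a j) (b j)) (fun j e f => ?_) _ 0 1
  exact siteBlock_mem_laurentFun q c i j (a j) (b j) e f

/-- Every component of the Bethe vector is `∏_{j<k}[q w_j/w_k]` times a Laurent polynomial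
(written here as a polynomial divided by a monomial). -/
theorem stmt11 (q c : ℂ) (hq : q ≠ 0) (hq4 : q^4 ≠ 1) (hc : c^2 = br q * br (q^2))
    (N : ℕ) (hN : 1 ≤ N) (σ : Fin N → Fin 3) :
    ∃ (p : MvPolynomial (Fin N) ℂ) (d : Fin N → ℕ),
      ∀ w : Fin N → ℂ, (∀ j, w j ≠ 0) →
        bethe q c w σ =
          (∏ pr ∈ Finset.univ.filter (fun pr : Fin N × Fin N => pr.1 < pr.2),
              br (q * w pr.1 / w pr.2)) *
            (MvPolynomial.eval w p / ∏ j, w j ^ d j) := by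
  obtain ⟨p, d, hp⟩ := bethe_mem_laurentFun q c σ
  set s := Finset.univ.filter (fun pr : Fin N × Fin N => pr.1 < pr.2) with hs
  have hε : ∀ ε ∈ ({1, -1} : Finset ℂ), ε = 1 ∨ ε = -1 := fun ε h => by simpa using h
  have hdvd : ∏ x ∈ s ×ˢ ({1, -1} : Finset ℂ),
      (MvPolynomial.X x.1.2 - MvPolynomial.C (x.2 * q) * MvPolynomial.X x.1.1) ∣
        p * ∏ j, MvPolynomial.X j := by
    refine Finset.prod_dvd_of_isRelPrime (fun x hx y hy hxy => ?_) fun x hx => ?_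
    · simp only [hs, Finset.coe_product, Set.mem_prod, Finset.mem_coe, Finset.mem_filter,
        Finset.mem_univ, true_and] at hx hy
      refine isRelPrime_X_sub_C_mul_X hx.1 hy.1 (mul_ne_zero ?_ hq) ?_
      · rcases hε _ hx.2 with h | h <;> simp [h]
      · rintro ⟨h1, h2, h3⟩
        exact hxy (Prod.ext (Prod.ext h1 h2) (mul_right_cancel₀ hq h3))
    · simp only [hs, Finset.mem_product, Finset.mem_filter, Finset.mem_univ, true_and] at hx
      refine X_sub_C_mul_X_dvd_of_eval hx.1.ne fun w hw => ?_
      by_cases hw0 : ∀ j, w j ≠ 0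
      · have h := hp w hw0
        simp only [bethe_eq_zero hq hq4 (hε _ hx.2) hc hw0 hx.1 hw, Pi.zero_apply] at h
        have h1 : ∏ j, w j ^ d j ≠ 0 :=
          Finset.prod_ne_zero_iff.2 fun j _ => pow_ne_zero _ (hw0 j)
        rw [map_mul, (div_eq_zero_iff.1 h.symm).resolve_right h1, zero_mul]
      · push Not at hw0
        obtain ⟨j, hj⟩ := hw0
        rw [map_mul, map_prod, Finset.prod_eq_zero (Finset.mem_univ j) (by simpa using hj),
          mul_zero]
  obtain ⟨r, hr⟩ := hdvd
  have hmem := mul_mem (eval_mem_laurentFun (r * ∏ pr ∈ s,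
    (MvPolynomial.C (-q) * MvPolynomial.X pr.1 * MvPolynomial.X pr.2)))
    (inv_mem_laurentFun (d + 1))
  obtain ⟨p', d', hp'⟩ := hmem
  refine ⟨p', d', fun w hw => ?_⟩
  have hpw := hp w hw
  simp only at hpw
  rw [hpw, ← hp' w hw]
  have hrw := congrArg (MvPolynomial.eval w) hr
  rw [Finset.prod_product] at hrw
  have h1 : (1 : ℂ) ≠ -1 := by norm_num
  simp only [Finset.prod_pair h1, map_mul, map_prod, map_sub, MvPolynomial.eval_X,
    MvPolynomial.eval_C] at hrw
  have hbr : ∏ pr ∈ s, ((w pr.2 - 1 * q * w pr.1) * (w pr.2 - -1 * q * w pr.1)) =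
      (∏ pr ∈ s, br (q * w pr.1 / w pr.2)) * ∏ pr ∈ s, (-q * w pr.1 * w pr.2) := by
    rw [← Finset.prod_mul_distrib]
    refine Finset.prod_congr rfl fun pr _ => ?_
    have ha := hw pr.1
    have hb := hw pr.2
    simp only [br]
    field_simp
    ring
  have hd : ∏ j, w j ≠ 0 := Finset.prod_ne_zero_iff.2 fun j _ => hw j
  have hd' : ∏ j, w j ^ d j ≠ 0 := Finset.prod_ne_zero_iff.2 fun j _ => pow_ne_zero _ (hw j)
  simp only [Pi.mul_apply, map_mul, map_prod, MvPolynomial.eval_X, MvPolynomial.eval_C,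
    Pi.add_apply, Pi.one_apply, pow_add, pow_one, Finset.prod_mul_distrib (s := Finset.univ)]
  rw [hbr] at hrw
  rw [← div_eq_mul_inv, mul_div_assoc', div_eq_div_iff hd' (mul_ne_zero hd' hd)]
  linear_combination (∏ j, w j ^ d j) * hrw

end
end
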